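/- arXiv:2205.02770 — 2 statements merged into one kernel-verified Lean document; each statement's English description precedes it below -/
import Mathlib

section
/- Let ξ₁, ξ₂, ξ₃ ∈ [−1,1], δ ∈ (0,1], and a, b ∈ ℝ with |(ξ₁,ξ₁²)+(ξ₂,ξ₂²)+(ξ₃,ξ₃²) − (a,b)| ≤ δ. Set r := 6b − 2a² and A(ξ₁,ξ₂) := (3(ξ₁+ξ₂), √3(ξ₁−ξ₂)). There is an absolute constant C > 0 such that: if r ≤ δ then |A(ξ₁,ξ₂) − (2a,0)| ≤ C√δ, and if r > δ then ||A(ξ₁,ξ₂) − (2a,0)| − √r| ≤ Cδ/√r. -/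
/-- If `x` is within `η` of `r > 0`, then `√x` is within `η / √r` of `√r`. -/
theorem abs_sqrt_sub_sqrt_le_div {x r η : ℝ} (hx : 0 ≤ x) (hr : 0 < r) (h : |x - r| ≤ η) :
    |√x - √r| ≤ η / √r := by
  have hr' : 0 < √r := Real.sqrt_pos.2 hr
  rw [le_div_iff₀ hr']
  calc |√x - √r| * √r ≤ |√x - √r| * (√x + √r) := by
        gcongr
        exact le_add_of_nonneg_left (Real.sqrt_nonneg x)
    _ = |(√x - √r) * (√x + √r)| := by
        rw [abs_mul, abs_of_nonneg (add_nonneg (Real.sqrt_nonneg x) hr'.le)]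
    _ = |x - r| := by
        congr 1
        linear_combination Real.sq_sqrt hx - Real.sq_sqrt hr.le
    _ ≤ η := h

/-- The squared distance from `(3 (x + y), √3 (x - y))` to `(2 a, 0)` is within `24 δ` of
`6 b - 2 a ^ 2`. -/
theorem abs_dist_sq_sub_le {x y z δ a b : ℝ} (hz : |z| ≤ 1) (hδ : δ ≤ 1)
    (ha : |x + y + z - a| ≤ δ) (hb : |x ^ 2 + y ^ 2 + z ^ 2 - b| ≤ δ) :
    |(3 * (x + y) - 2 * a) ^ 2 + (√3 * (x - y)) ^ 2 - (6 * b - 2 * a ^ 2)| ≤ 24 * δ := by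
  have key : (3 * (x + y) - 2 * a) ^ 2 + (√3 * (x - y)) ^ 2 - (6 * b - 2 * a ^ 2) =
      6 * ((x + y + z - a) * (x + y + z - a - 2 * z) + (x ^ 2 + y ^ 2 + z ^ 2 - b)) := by
    linear_combination (x - y) ^ 2 * Real.sq_sqrt (show (0 : ℝ) ≤ 3 by norm_num)
  have hfactor : |x + y + z - a - 2 * z| ≤ 3 := by
    rw [abs_le] at *
    constructor <;> linarith
  have hδ₀ : 0 ≤ δ := (abs_nonneg _).trans ha
  have hprod : |(x + y + z - a) * (x + y + z - a - 2 * z)| ≤ δ * 3 := by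
    rw [abs_mul]
    exact mul_le_mul ha hfactor (abs_nonneg _) hδ₀
  rw [key, abs_le]
  rw [abs_le] at hprod hb
  constructor <;> linarith


theorem stmt_3 :
    ∃ C > 0, ∀ (ξ₁ ξ₂ ξ₃ δ a b : ℝ),
      ξ₁ ∈ Set.Icc (-1 : ℝ) 1 → ξ₂ ∈ Set.Icc (-1 : ℝ) 1 → ξ₃ ∈ Set.Icc (-1 : ℝ) 1 →
      0 < δ → δ ≤ 1 →
      Real.sqrt (((ξ₁ + ξ₂ + ξ₃) - a) ^ 2 + ((ξ₁ ^ 2 + ξ₂ ^ 2 + ξ₃ ^ 2) - b) ^ 2) ≤ δ →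
      ((6 * b - 2 * a ^ 2 ≤ δ →
          Real.sqrt ((3 * (ξ₁ + ξ₂) - 2 * a) ^ 2 + (Real.sqrt 3 * (ξ₁ - ξ₂)) ^ 2)
            ≤ C * Real.sqrt δ) ∧
        (δ < 6 * b - 2 * a ^ 2 →
          |Real.sqrt ((3 * (ξ₁ + ξ₂) - 2 * a) ^ 2 + (Real.sqrt 3 * (ξ₁ - ξ₂)) ^ 2)
              - Real.sqrt (6 * b - 2 * a ^ 2)|
            ≤ C * δ / Real.sqrt (6 * b - 2 * a ^ 2))) := by
  refine ⟨24, by norm_num, fun ξ₁ ξ₂ ξ₃ δ a b _ _ h₃ hδ hδ₁ h => ?_⟩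
  have hdist := abs_dist_sq_sub_le (abs_le.2 h₃) hδ₁
    ((Real.abs_le_sqrt (le_add_of_nonneg_right (sq_nonneg _))).trans h)
    ((Real.abs_le_sqrt (le_add_of_nonneg_left (sq_nonneg _))).trans h)
  refine ⟨fun hr => ?_, fun hr => ?_⟩
  · refine Real.sqrt_le_iff.2 ⟨by positivity, ?_⟩
    rw [mul_pow 24, Real.sq_sqrt hδ.le]
    linarith [(abs_le.1 hdist).2]
  · exact abs_sqrt_sub_sqrt_le_div (by positivity) (hδ.trans hr) hdist
end

section
/- Let μ be a nontrivial finite Borel measure on ℝᵈ, ψ_δ a standard approximate identity as above, and suppose ‖μ ∗ ψ_δ‖²_{L²} ≤ δ^{s−d} for all sufficiently small δ > 0, where s ∈ [0,d]. Then for every 0 < σ < s, ∫ |μ̂(ξ)|² |ξ|^{σ−d} dξ < ∞; in particular the Hausdorff dimension of supp μ is at least s. -/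
open MeasureTheory Set Real
open scoped RealInnerProductSpace

/-- The support of a Borel measure on Euclidean space. -/
def measSupport' {d : ℕ} (μ : Measure (EuclideanSpace ℝ (Fin d))) :
    Set (EuclideanSpace ℝ (Fin d)) :=
  {x | ∀ r > 0, 0 < μ (Metric.ball x r)}

/-- The Fourier transform of a measure on Euclidean space. -/
noncomputable def measFT {d : ℕ} (μ : Measure (EuclideanSpace ℝ (Fin d)))
    (ξ : EuclideanSpace ℝ (Fin d)) : ℂ :=
  ∫ x, Complex.exp (-(2 * π * ⟪x, ξ⟫ : ℝ) * Complex.I) ∂μ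

section Gaussian

variable {d : ℕ} (μ : Measure (EuclideanSpace ℝ (Fin d))) [IsFiniteMeasure μ]

lemma norm_measFT_sq (ξ : EuclideanSpace ℝ (Fin d)) :
    ((‖measFT μ ξ‖ ^ 2 : ℝ) : ℂ) =
      ∫ p, Complex.exp (-(2 * π * ⟪p.1 - p.2, ξ⟫ : ℝ) * Complex.I) ∂(μ.prod μ) := by
  have hconj : (starRingEnd ℂ) (measFT μ ξ) =
      ∫ x, Complex.exp ((2 * π * ⟪x, ξ⟫ : ℝ) * Complex.I) ∂μ := by
    rw [measFT, ← integral_conj]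
    congr with x
    rw [← Complex.exp_conj, map_mul, map_neg, Complex.conj_ofReal, Complex.conj_I, neg_mul_neg]
  rw [Complex.ofReal_pow, ← Complex.mul_conj', hconj, measFT, ← integral_prod_mul]
  congr with p
  rw [← Complex.exp_add, inner_sub_left]
  congr 1
  push_cast
  ring

lemma integral_norm_measFT_sq_mul_gaussian {t : ℝ} (ht : 0 < t) :
    Integrable (fun ξ ↦ ‖measFT μ ξ‖ ^ 2 * rexp (-(π * t) * ‖ξ‖ ^ 2)) ∧
    ∫ ξ, ‖measFT μ ξ‖ ^ 2 * rexp (-(π * t) * ‖ξ‖ ^ 2) =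
      ∫ p, t⁻¹ ^ (d / 2 : ℝ) * rexp (-(π * dist p.1 p.2 ^ 2 / t)) ∂(μ.prod μ) := by
  set b : ℂ := ((π * t : ℝ) : ℂ) with hb_def
  have hb : 0 < b.re := by simp only [hb_def, Complex.ofReal_re]; positivity
  set c : ℂ := -(2 * π) * Complex.I with hc_def
  let F : (EuclideanSpace ℝ (Fin d) × EuclideanSpace ℝ (Fin d)) × EuclideanSpace ℝ (Fin d) → ℂ :=
    fun q ↦ Complex.exp (-b * ‖q.2‖ ^ 2 + c * ⟪q.1.1 - q.1.2, q.2⟫)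
  have hgauss : Integrable (fun ξ : EuclideanSpace ℝ (Fin d) ↦ rexp (-(π * t) * ‖ξ‖ ^ 2)) := by
    have h := (GaussianFourier.integrable_cexp_neg_mul_sq_norm_add hb 0
      (0 : EuclideanSpace ℝ (Fin d))).norm
    refine h.congr (.of_forall fun ξ ↦ ?_)
    simp only [Complex.norm_exp]
    norm_cast
    simp [hb_def, -Complex.ofReal_pow]
  have hnorm : ∀ q, ‖F q‖ = rexp (-(π * t) * ‖q.2‖ ^ 2) := by
    intro q
    simp only [F, Complex.norm_exp]
    simp [hb_def, hc_def, ← Complex.ofReal_pow]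
  have hF : Integrable F ((μ.prod μ).prod volume) := by
    refine Integrable.mono' ((integrable_const (1 : ℝ)).mul_prod hgauss) ?_ (.of_forall fun q ↦ ?_)
    · exact (by fun_prop : Continuous F).aestronglyMeasurable
    · simp [hnorm]
  have hinner : ∀ ξ : EuclideanSpace ℝ (Fin d), ∫ p, F (p, ξ) ∂(μ.prod μ) =
      ((‖measFT μ ξ‖ ^ 2 * rexp (-(π * t) * ‖ξ‖ ^ 2) : ℝ) : ℂ) := by
    intro ξ
    rw [Complex.ofReal_mul, norm_measFT_sq, ← integral_mul_const]
    congr with p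
    rw [Complex.ofReal_exp, ← Complex.exp_add]
    simp only [F, hb_def, hc_def]
    congr 1
    push_cast
    ring
  have houter : ∀ p : EuclideanSpace ℝ (Fin d) × EuclideanSpace ℝ (Fin d), ∫ ξ, F (p, ξ) =
      ((t⁻¹ ^ (d / 2 : ℝ) * rexp (-(π * dist p.1 p.2 ^ 2 / t)) : ℝ) : ℂ) := by
    intro p
    simp only [F]
    rw [GaussianFourier.integral_cexp_neg_mul_sq_norm_add hb]
    rw [Complex.ofReal_mul, Complex.ofReal_cpow (by positivity), Complex.ofReal_exp, dist_eq_norm]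
    have ht' : (t : ℂ) ≠ 0 := by exact_mod_cast ht.ne'
    have hπ : (π : ℂ) ≠ 0 := by exact_mod_cast pi_ne_zero
    congr 2
    · rw [hb_def]; push_cast; field_simp
    · simp
    · rw [hb_def, hc_def, mul_pow, Complex.I_sq]; push_cast; field_simp; ring
  constructor
  · have h := hF.integral_prod_right.re
    refine h.congr (.of_forall fun ξ ↦ ?_)
    simp only [hinner]
    exact Complex.ofReal_re _
  · have h := integral_integral_swap (f := fun p ξ ↦ F (p, ξ)) hF
    simp only [hinner, houter] at h
    rw [integral_complex_ofReal, integral_complex_ofReal] at h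
    exact_mod_cast h.symm

end Gaussian

section Correlation

variable {d : ℕ} (μ : Measure (EuclideanSpace ℝ (Fin d))) [IsFiniteMeasure μ]

lemma prod_dist_lt_mul_volume_ball_le (r : ℝ) :
    (μ.prod μ) {p | dist p.1 p.2 < r} * volume (Metric.ball (0 : EuclideanSpace ℝ (Fin d)) r) ≤
      ∫⁻ x, μ (Metric.ball x (2 * r)) ^ 2 := by
  let S : Set (EuclideanSpace ℝ (Fin d) × EuclideanSpace ℝ (Fin d) × EuclideanSpace ℝ (Fin d)) :=
    {q | dist q.2.1 q.1 < 2 * r ∧ dist q.2.2 q.1 < 2 * r}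
  have hS : MeasurableSet S := by
    simp only [S, ofPred_and]
    exact (measurableSet_lt (by fun_prop) (by fun_prop)).inter
      (measurableSet_lt (by fun_prop) (by fun_prop))
  have hD : MeasurableSet {p : EuclideanSpace ℝ (Fin d) × EuclideanSpace ℝ (Fin d) |
      dist p.1 p.2 < r} := (isOpen_lt (by fun_prop) (by fun_prop)).measurableSet
  calc (μ.prod μ) {p | dist p.1 p.2 < r} * volume (Metric.ball (0 : EuclideanSpace ℝ (Fin d)) r)
      = ∫⁻ _ in {p : EuclideanSpace ℝ (Fin d) × EuclideanSpace ℝ (Fin d) | dist p.1 p.2 < r},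
          volume (Metric.ball (0 : EuclideanSpace ℝ (Fin d)) r) ∂(μ.prod μ) := by
        rw [setLIntegral_const, mul_comm]
    _ ≤ ∫⁻ p in {p : EuclideanSpace ℝ (Fin d) × EuclideanSpace ℝ (Fin d) | dist p.1 p.2 < r},
          volume ((fun x ↦ (x, p)) ⁻¹' S) ∂(μ.prod μ) := by
        refine setLIntegral_mono_ae' hD (.of_forall fun p hp ↦ ?_)
        rw [← Measure.addHaar_ball_center volume p.1]
        refine measure_mono fun x hx ↦ ?_
        rw [Metric.mem_ball, dist_comm] at hx
        rw [mem_ofPred_eq, dist_comm] at hp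
        have := dist_triangle p.2 p.1 x
        have := dist_nonneg (x := p.1) (y := x)
        exact ⟨by linarith, by linarith⟩
    _ ≤ ∫⁻ p, volume ((fun x ↦ (x, p)) ⁻¹' S) ∂(μ.prod μ) := setLIntegral_le_lintegral _ _
    _ = (volume.prod (μ.prod μ)) S := (Measure.prod_apply_symm hS).symm
    _ = ∫⁻ x, (μ.prod μ) (Prod.mk x ⁻¹' S) := Measure.prod_apply hS
    _ = ∫⁻ x, μ (Metric.ball x (2 * r)) ^ 2 := by
        congr with x
        rw [sq, ← Measure.prod_prod]
        rfl

lemma integrable_average {ψ : EuclideanSpace ℝ (Fin d) → ℝ} (hψ : Continuous ψ)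
    (hψ_supp : HasCompactSupport ψ) {δ : ℝ} (hδ : 0 < δ) (c : ℝ) :
    Integrable (fun x ↦ (∫ y, c * ψ (δ⁻¹ • (x - y)) ∂μ) ^ 2) := by
  obtain ⟨M, hM⟩ := hψ.bounded_above_of_compact_support hψ_supp
  have hint : Integrable (fun x ↦ ψ (δ⁻¹ • x)) :=
    (hψ.integrable_of_hasCompactSupport hψ_supp).comp_smul (inv_pos.2 hδ).ne'
  have hprod : Integrable (fun q : EuclideanSpace ℝ (Fin d) × EuclideanSpace ℝ (Fin d) ↦
      c * ψ (δ⁻¹ • (q.1 - q.2))) (volume.prod μ) := by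
    refine Integrable.const_mul ?_ c
    rw [integrable_prod_iff' (by fun_prop)]
    refine ⟨.of_forall fun y ↦ hint.comp_sub_right y, ?_⟩
    have h : ∀ y, ∫ x, ‖ψ (δ⁻¹ • (x - y))‖ = ∫ x, ‖ψ (δ⁻¹ • x)‖ := fun y ↦
      integral_sub_right_eq_self (fun x ↦ ‖ψ (δ⁻¹ • x)‖) y
    simp only [h]
    exact integrable_const _
  have h := hprod.integral_prod_left
  simp only [sq]
  refine h.bdd_mul h.aestronglyMeasurable (c := |c| * M * μ.real univ) (.of_forall fun x ↦ ?_)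
  refine (norm_integral_le_of_norm_le_const (C := |c| * M) (.of_forall fun y ↦ ?_))
  rw [norm_mul, Real.norm_eq_abs]
  gcongr
  exact hM _

lemma lintegral_measure_ball_sq_le {ψ : EuclideanSpace ℝ (Fin d) → ℝ} (hψ : Continuous ψ)
    (hψ_supp : HasCompactSupport ψ) (hψ_nonneg : ∀ x, 0 ≤ ψ x)
    {a : EuclideanSpace ℝ (Fin d)} {c ρ : ℝ} (hc : 0 < c)
    (hball : ∀ x ∈ Metric.ball a ρ, c ≤ ψ x) {δ A : ℝ} (hδ : 0 < δ)
    (hA : ∫ x, (∫ y, δ ^ (-(d : ℝ)) * ψ (δ⁻¹ • (x - y)) ∂μ) ^ 2 ≤ A) :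
    ∫⁻ x, μ (Metric.ball x (δ * ρ)) ^ 2 ≤ ENNReal.ofReal (c⁻¹ ^ 2 * δ ^ (2 * d : ℝ) * A) := by
  obtain ⟨M, hM⟩ := hψ.bounded_above_of_compact_support hψ_supp
  have hpt : ∀ x, μ.real (Metric.ball (x - δ • a) (δ * ρ)) ≤
      c⁻¹ * δ ^ (d : ℝ) * ∫ y, δ ^ (-(d : ℝ)) * ψ (δ⁻¹ • (x - y)) ∂μ := by
    intro x
    have hint : Integrable (fun y ↦ ψ (δ⁻¹ • (x - y))) μ :=
      Integrable.of_bound (by fun_prop) M (.of_forall fun y ↦ hM _)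
    have h : c * μ.real (Metric.ball (x - δ • a) (δ * ρ)) ≤ ∫ y, ψ (δ⁻¹ • (x - y)) ∂μ := by
      calc c * μ.real (Metric.ball (x - δ • a) (δ * ρ))
          = ∫ _ in Metric.ball (x - δ • a) (δ * ρ), c ∂μ := by
            rw [setIntegral_const, smul_eq_mul, mul_comm]
        _ ≤ ∫ y in Metric.ball (x - δ • a) (δ * ρ), ψ (δ⁻¹ • (x - y)) ∂μ := by
            refine setIntegral_mono_on (integrable_const _) hint.integrableOn
              measurableSet_ball fun y hy ↦ hball _ ?_
            rw [Metric.mem_ball, dist_eq_norm] at hy ⊢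
            have : δ⁻¹ • (x - y) - a = -(δ⁻¹ • (y - (x - δ • a))) := by
              simp only [smul_sub, smul_smul, inv_mul_cancel₀ hδ.ne', one_smul]
              abel
            rw [this, norm_neg, norm_smul, norm_inv, Real.norm_of_nonneg hδ.le]
            rwa [inv_mul_lt_iff₀ hδ]
        _ ≤ ∫ y, ψ (δ⁻¹ • (x - y)) ∂μ :=
            setIntegral_le_integral hint (.of_forall fun y ↦ hψ_nonneg _)
    rw [integral_const_mul, rpow_neg hδ.le]
    have hδd' : δ ^ (d : ℝ) ≠ 0 := (rpow_pos_of_pos hδ _).ne'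
    rw [mul_assoc, mul_inv_cancel_left₀ hδd', ← div_eq_inv_mul, le_div_iff₀ hc]
    linarith
  calc ∫⁻ x, μ (Metric.ball x (δ * ρ)) ^ 2
      = ∫⁻ x, μ (Metric.ball (x - δ • a) (δ * ρ)) ^ 2 :=
        (lintegral_sub_right_eq_self (fun x ↦ μ (Metric.ball x (δ * ρ)) ^ 2) (δ • a)).symm
    _ ≤ ∫⁻ x, ENNReal.ofReal (c⁻¹ ^ 2 * δ ^ (2 * d : ℝ) *
          (∫ y, δ ^ (-(d : ℝ)) * ψ (δ⁻¹ • (x - y)) ∂μ) ^ 2) := by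
        refine lintegral_mono fun x ↦ ?_
        rw [← ofReal_measureReal, ← ENNReal.ofReal_pow measureReal_nonneg]
        refine ENNReal.ofReal_le_ofReal
          ((pow_le_pow_left₀ measureReal_nonneg (hpt x) 2).trans_eq ?_)
        rw [mul_pow, mul_pow, two_mul, rpow_add hδ, ← sq]
    _ = ENNReal.ofReal (∫ x, c⁻¹ ^ 2 * δ ^ (2 * d : ℝ) *
          (∫ y, δ ^ (-(d : ℝ)) * ψ (δ⁻¹ • (x - y)) ∂μ) ^ 2) := by
        refine (ofReal_integral_eq_lintegral_ofReal
          ((integrable_average μ hψ hψ_supp hδ _).const_mul _) (.of_forall fun x ↦ ?_)).symm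
        positivity
    _ ≤ _ := by
        rw [integral_const_mul]
        gcongr

lemma exists_prod_dist_lt_le {ψ : EuclideanSpace ℝ (Fin d) → ℝ} (hψ : Continuous ψ)
    (hψ_supp : HasCompactSupport ψ) (hψ_nonneg : ∀ x, 0 ≤ ψ x) (hψ_ne : ψ ≠ 0) {s δ₀ : ℝ}
    (hδ₀ : 0 < δ₀) (hs : 0 ≤ s)
    (hL2 : ∀ δ : ℝ, 0 < δ → δ ≤ δ₀ →
      ∫ x, (∫ y, δ ^ (-(d : ℝ)) * ψ (δ⁻¹ • (x - y)) ∂μ) ^ 2 ≤ δ ^ (s - d)) :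
    ∃ C, ∀ r, 0 < r → (μ.prod μ).real {p | dist p.1 p.2 < r} ≤ C * r ^ s := by
  obtain ⟨a, ha⟩ := Function.ne_iff.1 hψ_ne
  have ha : 0 < ψ a := (hψ_nonneg a).lt_of_ne' ha
  obtain ⟨ρ, hρ, hball⟩ := Metric.eventually_nhds_iff_ball.1
    (hψ.continuousAt.eventually_const_lt (half_lt_self ha))
  set c := ψ a / 2
  have hc : 0 < c := half_pos ha
  set V := volume.real (Metric.ball (0 : EuclideanSpace ℝ (Fin d)) 1)
  have hV : 0 < V :=
    ENNReal.toReal_pos (Metric.measure_ball_pos _ _ one_pos).ne' measure_ball_lt_top.ne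
  set K := c⁻¹ ^ 2 * (2 / ρ) ^ (s + d) with hK_def
  set M := (μ.prod μ).real univ
  have hM : 0 ≤ M := measureReal_nonneg
  set r₀ := δ₀ * ρ / 2 with hr₀_def
  have hr₀ : 0 < r₀ := by positivity
  refine ⟨K / V + M / r₀ ^ s, fun r hr ↦ ?_⟩
  have hrs : 0 < r ^ s := rpow_pos_of_pos hr s
  rw [add_mul]
  rcases le_or_gt r r₀ with hle | hlt
  · set δ := 2 / ρ * r with hδ_def
    have hδ : 0 < δ := by positivity
    have hδle : δ ≤ δ₀ := by
      calc δ ≤ 2 / ρ * r₀ := by rw [hδ_def]; gcongr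
        _ = δ₀ := by rw [hr₀_def]; field_simp
    have h1 := lintegral_measure_ball_sq_le μ hψ hψ_supp hψ_nonneg hc
      (fun x hx ↦ (hball x hx).le) hδ (hL2 δ hδ hδle)
    have hδρ : δ * ρ = 2 * r := by rw [hδ_def]; field_simp
    rw [hδρ] at h1
    have h2 := (prod_dist_lt_mul_volume_ball_le μ r).trans h1
    have h3 := ENNReal.toReal_mono ENNReal.ofReal_ne_top h2
    have hδpow : δ ^ (2 * d : ℝ) * δ ^ (s - d) = (2 / ρ) ^ (s + d) * (r ^ s * r ^ (d : ℝ)) := by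
      rw [← rpow_add hδ, ← rpow_add hr, hδ_def, ← mul_rpow (by positivity) hr.le]
      congr 1
      ring
    rw [ENNReal.toReal_ofReal (by positivity), ENNReal.toReal_mul,
      Measure.addHaar_ball_of_pos _ _ hr, ENNReal.toReal_mul, ENNReal.toReal_ofReal (by positivity),
      mul_assoc, hδpow, finrank_euclideanSpace, Fintype.card_fin, rpow_natCast] at h3
    have hrd : 0 < r ^ d := by positivity
    have h4 : (μ.prod μ).real {p | dist p.1 p.2 < r} * V ≤ K * r ^ s := by
      refine le_of_mul_le_mul_right ?_ hrd
      calc _ = (μ.prod μ).real {p | dist p.1 p.2 < r} * (r ^ d * V) := by ring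
        _ ≤ _ := h3
        _ = _ := by rw [hK_def]; ring
    have h5 : 0 ≤ M / r₀ ^ s * r ^ s := by positivity
    have h6 : (μ.prod μ).real {p | dist p.1 p.2 < r} ≤ K / V * r ^ s := by
      rwa [div_mul_eq_mul_div, le_div_iff₀ hV]
    linarith
  · have h1 : (μ.prod μ).real {p | dist p.1 p.2 < r} ≤ M := measureReal_mono (subset_univ _)
    have h2 : M ≤ M / r₀ ^ s * r ^ s := by
      rw [div_mul_eq_mul_div, le_div_iff₀ (by positivity)]
      exact mul_le_mul_of_nonneg_left (rpow_le_rpow hr₀.le hlt.le hs) hM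
    have h3 : 0 ≤ K / V * r ^ s := by positivity
    linarith

end Correlation

section Dimension

variable {X : Type*} [MetricSpace X] [MeasurableSpace X] [BorelSpace X]

lemma hausdorffMeasure_ne_zero_of_measure_ball_le {μ : Measure X} {A S : Set X}
    (hA : MeasurableSet A) (hμA : μ A ≠ 0) (hS : μ Sᶜ = 0) {σ : ℝ} (hσ : 0 < σ) {N : ℕ}
    (h : ∀ y ∈ A, ∀ k ≥ N, μ {z | dist y z < (1 / 2) ^ k} ≤ ENNReal.ofReal (((1 / 2) ^ k) ^ σ)) :
    μH[σ] S ≠ 0 := by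
  have hkey : ∀ (E : Set X) (k : ℕ), N ≤ k → Metric.ediam E < ENNReal.ofReal ((1 / 2) ^ k) →
      μ (E ∩ A) ≤ ENNReal.ofReal (((1 / 2) ^ k) ^ σ) := by
    intro E k hk hE
    rcases (E ∩ A).eq_empty_or_nonempty with hemp | ⟨y, hyE, hyA⟩
    · simp [hemp]
    · refine (measure_mono fun z hz ↦ ?_).trans (h y hyA k hk)
      have := (Metric.edist_le_ediam_of_mem hyE hz.1).trans_lt hE
      rwa [edist_dist, ENNReal.ofReal_lt_ofReal_iff (by positivity)] at this
  have hbound : ∀ E : Set X, Metric.ediam E ≤ ENNReal.ofReal ((1 / 2) ^ (N + 1)) →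
      μ (E ∩ A) ≤ ENNReal.ofReal (4 ^ σ) * Metric.ediam E ^ σ := by
    intro E hE
    have hfin : Metric.ediam E ≠ ⊤ := ne_top_of_le_ne_top ENNReal.ofReal_ne_top hE
    obtain ⟨D, hD0, hD⟩ : ∃ D : ℝ, 0 ≤ D ∧ Metric.ediam E = ENNReal.ofReal D :=
      ⟨_, ENNReal.toReal_nonneg, (ENNReal.ofReal_toReal hfin).symm⟩
    rw [hD] at hE ⊢
    rcases hD0.eq_or_lt with rfl | hDpos
    · have hlim : Filter.Tendsto (fun k : ℕ ↦ ENNReal.ofReal (((1 / 2 : ℝ) ^ k) ^ σ)) Filter.atTop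
          (nhds 0) := by
        have h1 := (tendsto_pow_atTop_nhds_zero_of_lt_one (r := (1 / 2 : ℝ)) (by norm_num)
          (by norm_num)).rpow_const (p := σ) (.inr hσ.le)
        rw [zero_rpow hσ.ne'] at h1
        simpa using ENNReal.tendsto_ofReal h1
      refine (ge_of_tendsto hlim ?_).trans zero_le
      filter_upwards [Filter.eventually_ge_atTop N] with k hk
      refine hkey E k hk ?_
      rw [hD]
      exact (ENNReal.ofReal_lt_ofReal_iff (by positivity)).2 (by positivity)
    · have hDle : 2 * D ≤ (1 / 2) ^ N := by
        have := (ENNReal.ofReal_le_ofReal_iff (by positivity)).1 hE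
        rw [pow_succ] at this
        linarith
      obtain ⟨k, hk1, hk2⟩ := exists_nat_pow_near_of_lt_one (by positivity : 0 < 2 * D)
        (hDle.trans (pow_le_one₀ (by norm_num) (by norm_num)))
        (by norm_num : (0 : ℝ) < 1 / 2) (by norm_num)
      have hNk : N ≤ k := Nat.lt_succ_iff.1
        ((pow_lt_pow_iff_right_of_lt_one₀ (by norm_num) (by norm_num)).1 (hk1.trans_le hDle))
      refine (hkey E k hNk ?_).trans ?_
      · rw [hD, ENNReal.ofReal_lt_ofReal_iff (by positivity)]
        linarith
      · rw [ENNReal.ofReal_rpow_of_nonneg hD0 hσ.le, ← ENNReal.ofReal_mul (by positivity),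
          ← mul_rpow (by norm_num) hD0]
        refine ENNReal.ofReal_le_ofReal (rpow_le_rpow (by positivity) ?_ hσ.le)
        rw [pow_succ] at hk1
        linarith
  have hc0 : ENNReal.ofReal (4 ^ σ) ≠ 0 := (ENNReal.ofReal_pos.2 (by positivity)).ne'
  have hle : (ENNReal.ofReal (4 ^ σ))⁻¹ • μ.restrict A ≤ μH[σ] := by
    refine Measure.le_hausdorffMeasure σ _ (ENNReal.ofReal ((1 / 2) ^ (N + 1)))
      (ENNReal.ofReal_pos.2 (by positivity)) fun E hE ↦ ?_
    rw [Measure.smul_apply, Measure.restrict_apply' hA, smul_eq_mul,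
      ENNReal.inv_mul_le_iff hc0 ENNReal.ofReal_ne_top]
    exact hbound E hE
  have hSA : μ (S ∩ A) ≠ 0 := by
    rwa [inter_comm, measure_inter_conull hS]
  refine fun h0 ↦ hSA ?_
  have h1 := (hle S).trans_eq h0
  rw [Measure.smul_apply, Measure.restrict_apply' hA, smul_eq_mul, nonpos_iff_eq_zero,
    mul_eq_zero] at h1
  exact h1.resolve_left (ENNReal.inv_ne_zero.2 ENNReal.ofReal_ne_top)

lemma ofReal_le_dimH_of_prod_dist_lt_le [SecondCountableTopology X] {μ : Measure X}
    [IsFiniteMeasure μ] (hμ : μ ≠ 0) {S : Set X} (hS : μ Sᶜ = 0) {C s σ : ℝ}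
    (h : ∀ r, 0 < r → (μ.prod μ).real {p | dist p.1 p.2 < r} ≤ C * r ^ s)
    (hσ : 0 < σ) (hσs : σ < s) : ENNReal.ofReal σ ≤ dimH S := by
  have hC : 0 ≤ C := by simpa using measureReal_nonneg.trans (h 1 one_pos)
  have hD : ∀ r : ℝ, MeasurableSet {p : X × X | dist p.1 p.2 < r} := fun r ↦
    measurableSet_lt (by fun_prop) (by fun_prop)
  have hf : ∀ r : ℝ, Measurable fun y ↦ μ {z | dist y z < r} := fun r ↦
    measurable_measure_prodMk_left (hD r)
  have hmarkov : ∀ r : ℝ, 0 < r → μ {y | ENNReal.ofReal (r ^ σ) ≤ μ {z | dist y z < r}} ≤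
      ENNReal.ofReal (C * r ^ (s - σ)) := by
    intro r hr
    have h1 := mul_meas_ge_le_lintegral (μ := μ) (hf r) (ENNReal.ofReal (r ^ σ))
    have h2 : ∫⁻ y, μ {z | dist y z < r} ∂μ ≤ ENNReal.ofReal (C * r ^ s) :=
      (Measure.prod_apply (hD r)).symm.trans_le
        ((ENNReal.le_ofReal_iff_toReal_le (measure_ne_top _ _) (by positivity)).2 (h r hr))
    have hrσ : 0 < r ^ σ := rpow_pos_of_pos hr σ
    refine (ENNReal.mul_le_mul_iff_right (ENNReal.ofReal_pos.2 hrσ).ne' ENNReal.ofReal_ne_top).1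
      ((h1.trans h2).trans_eq ?_)
    rw [← ENNReal.ofReal_mul hrσ.le, mul_left_comm, ← rpow_add hr, add_sub_cancel]
  have hsum : ∑' k : ℕ, μ {y | ENNReal.ofReal (((1 / 2 : ℝ) ^ k) ^ σ) ≤
      μ {z | dist y z < (1 / 2) ^ k}} ≠ ⊤ := by
    have hgeom : Summable fun k : ℕ ↦ C * ((1 / 2 : ℝ) ^ k) ^ (s - σ) := by
      have heq : ∀ k : ℕ, ((1 / 2 : ℝ) ^ k) ^ (s - σ) = ((1 / 2 : ℝ) ^ (s - σ)) ^ k := fun k ↦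
        (rpow_pow_comm (by norm_num) _ _).symm
      simp only [heq]
      exact (summable_geometric_of_lt_one (by positivity)
        (rpow_lt_one (by norm_num) (by norm_num) (sub_pos.2 hσs))).mul_left C
    exact ne_top_of_le_ne_top hgeom.tsum_ofReal_ne_top
      (ENNReal.tsum_le_tsum fun k ↦ hmarkov _ (by positivity))
  set A : ℕ → Set X := fun N ↦ {y | ∀ k ≥ N,
    μ {z | dist y z < (1 / 2) ^ k} ≤ ENNReal.ofReal (((1 / 2 : ℝ) ^ k) ^ σ)} with hA_def
  have hA : ∀ N, MeasurableSet (A N) := fun N ↦ by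
    simp only [hA_def, ofPred_forall]
    exact .iInter fun k ↦ .iInter fun _ ↦ measurableSet_le (hf _) measurable_const
  obtain ⟨N, hN⟩ : ∃ N, μ (A N) ≠ 0 := by
    by_contra! hzero
    refine hμ (ae_eq_bot.1 (Filter.eventually_false_iff_eq_bot.1 ?_))
    filter_upwards [ae_eventually_notMem hsum,
      measure_eq_zero_iff_ae_notMem.1 (measure_iUnion_null hzero)] with y hy1 hy2
    obtain ⟨N, hN⟩ := Filter.eventually_atTop.1 hy1
    exact hy2 (mem_iUnion.2 ⟨N, fun k hk ↦ (not_le.1 (hN k hk)).le⟩)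
  refine le_dimH_of_hausdorffMeasure_ne_zero ?_
  rw [Real.coe_toNNReal σ hσ.le]
  exact hausdorffMeasure_ne_zero_of_measure_ball_le (hA N) hN hS hσ fun y hy k hk ↦ hy k hk

end Dimension

section Energy

lemma exists_exp_neg_le_rpow_neg (p : ℝ) : ∃ K, ∀ y, 1 ≤ y → rexp (-(π * y)) ≤ K * y ^ (-p) := by
  obtain ⟨n, hn⟩ := exists_nat_ge p
  refine ⟨n.factorial, fun y hy ↦ ?_⟩
  have hy0 : 0 < y := one_pos.trans_le hy
  have h1 : y ^ p ≤ n.factorial * rexp (π * y) := by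
    calc y ^ p ≤ y ^ (n : ℝ) := rpow_le_rpow_of_exponent_le hy hn
      _ = y ^ n := rpow_natCast y n
      _ ≤ n.factorial * rexp y := by
        rw [mul_comm]
        exact (div_le_iff₀ (by positivity)).1 (pow_div_factorial_le_exp y hy0.le n)
      _ ≤ n.factorial * rexp (π * y) := by
        gcongr
        nlinarith [pi_gt_three]
  rw [rpow_neg hy0.le, exp_neg, ← div_eq_mul_inv, le_div_iff₀ (rpow_pos_of_pos hy0 p),
    inv_mul_le_iff₀ (exp_pos _)]
  linarith

variable {X : Type*} [MetricSpace X] [SecondCountableTopology X] [MeasurableSpace X] [BorelSpace X]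

lemma integrable_exp_neg_dist_sq (ν : Measure (X × X)) [IsFiniteMeasure ν] {c : ℝ} (hc : 0 ≤ c) :
    Integrable (fun p ↦ rexp (-(c * dist p.1 p.2 ^ 2))) ν := by
  refine Integrable.of_bound (by fun_prop) 1 (.of_forall fun p ↦ ?_)
  rw [norm_of_nonneg (exp_pos _).le, exp_le_one_iff, neg_nonpos]
  positivity

lemma integral_exp_neg_dist_sq_le (ν : Measure (X × X)) [IsFiniteMeasure ν] {c : ℝ} (hc : 0 ≤ c)
    {r : ℝ} (hr : 0 ≤ r) :
    ∫ p, rexp (-(c * dist p.1 p.2 ^ 2)) ∂ν ≤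
      ν.real {p | dist p.1 p.2 < r} + rexp (-(c * r ^ 2)) * ν.real univ := by
  have hD : MeasurableSet {p : X × X | dist p.1 p.2 < r} :=
    measurableSet_lt (by fun_prop) (by fun_prop)
  calc ∫ p, rexp (-(c * dist p.1 p.2 ^ 2)) ∂ν
      ≤ ∫ p, ({p : X × X | dist p.1 p.2 < r}.indicator (fun _ ↦ 1) p + rexp (-(c * r ^ 2))) ∂ν := by
        refine integral_mono (integrable_exp_neg_dist_sq ν hc)
          (((integrable_const _).indicator hD).add (integrable_const _)) fun p ↦ ?_
        by_cases hp : dist p.1 p.2 < r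
        · rw [indicator_of_mem (by exact hp)]
          have h1 : rexp (-(c * dist p.1 p.2 ^ 2)) ≤ 1 := by
            rw [exp_le_one_iff, neg_nonpos]
            positivity
          have h2 := exp_pos (-(c * r ^ 2))
          linarith
        · rw [indicator_of_notMem (by exact hp), zero_add]
          push Not at hp
          gcongr
    _ = _ := by
        rw [integral_add ((integrable_const _).indicator hD) (integrable_const _),
          integral_indicator_const _ hD, integral_const, smul_eq_mul, mul_one, smul_eq_mul,
          mul_comm]

lemma exists_rpow_mul_integral_exp_neg_dist_sq_le (ν : Measure (X × X)) [IsFiniteMeasure ν]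
    {C s σ : ℝ} (h : ∀ r, 0 < r → ν.real {p | dist p.1 p.2 < r} ≤ C * r ^ s)
    (hσ : 0 < σ) (hσs : σ < s) :
    ∃ K ε : ℝ, 0 < ε ∧ ∀ x : ℝ, 1 ≤ x →
      x ^ σ * ∫ p, rexp (-(π * x ^ 2 * dist p.1 p.2 ^ 2)) ∂ν ≤ K * x ^ (-ε) := by
  have hs : 0 < s := hσ.trans hσs
  obtain ⟨a, ha1, ha2⟩ := exists_between ((div_lt_one hs).2 hσs)
  have ha3 : σ < a * s := (div_lt_iff₀ hs).1 ha1
  obtain ⟨K, hK⟩ := exists_exp_neg_le_rpow_neg (a * s / (2 * (1 - a)))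
  refine ⟨C + K * ν.real univ, a * s - σ, by linarith, fun x hx ↦ ?_⟩
  have hx0 : 0 < x := one_pos.trans_le hx
  have h1 := integral_exp_neg_dist_sq_le ν (c := π * x ^ 2) (by positivity)
    (rpow_nonneg hx0.le (-a))
  have h2 := h (x ^ (-a)) (rpow_pos_of_pos hx0 _)
  rw [← rpow_mul hx0.le, neg_mul] at h2
  have hy : x ^ 2 * (x ^ (-a)) ^ 2 = x ^ (2 * (1 - a)) := by
    rw [← mul_pow, ← rpow_one_add' hx0.le (by linarith), ← rpow_natCast, ← rpow_mul hx0.le]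
    congr 1
    push_cast
    ring
  have h3 := hK (x ^ (2 * (1 - a))) (one_le_rpow hx (by linarith))
  rw [← rpow_mul hx0.le, mul_neg, mul_div_cancel₀ _ (by linarith), ← hy, ← mul_assoc] at h3
  have hpow : x ^ σ * x ^ (-(a * s)) = x ^ (-(a * s - σ)) := by
    rw [← rpow_add hx0]
    congr 1
    ring
  calc x ^ σ * ∫ p, rexp (-(π * x ^ 2 * dist p.1 p.2 ^ 2)) ∂ν
      ≤ x ^ σ * (C * x ^ (-(a * s)) + K * x ^ (-(a * s)) * ν.real univ) := by
        refine mul_le_mul_of_nonneg_left (h1.trans ?_) (by positivity)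
        gcongr
    _ = (C + K * ν.real univ) * (x ^ σ * x ^ (-(a * s))) := by ring
    _ = _ := by rw [hpow]

lemma summable_zpow_rpow_mul_integral_exp_neg_dist_sq (ν : Measure (X × X)) [IsFiniteMeasure ν]
    {C s σ : ℝ} (h : ∀ r, 0 < r → ν.real {p | dist p.1 p.2 < r} ≤ C * r ^ s)
    (hσ : 0 < σ) (hσs : σ < s) :
    Summable fun k : ℤ ↦
      ((2 : ℝ) ^ k) ^ σ * ∫ p, rexp (-(π * ((2 : ℝ) ^ k) ^ 2 * dist p.1 p.2 ^ 2)) ∂ν := by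
  have hgeom : ∀ ε : ℝ, 0 < ε → Summable fun n : ℕ ↦ ((2 : ℝ) ^ n) ^ (-ε) := by
    intro ε hε
    have heq : ∀ n : ℕ, ((2 : ℝ) ^ n) ^ (-ε) = ((2 : ℝ) ^ (-ε)) ^ n := fun n ↦
      (rpow_pow_comm (by norm_num) _ _).symm
    simp only [heq]
    exact summable_geometric_of_lt_one (by positivity)
      (rpow_lt_one_of_one_lt_of_neg (by norm_num) (by linarith))
  have hnonneg : ∀ x : ℝ, 0 ≤ ∫ p, rexp (-(π * x ^ 2 * dist p.1 p.2 ^ 2)) ∂ν := fun x ↦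
    integral_nonneg fun p ↦ (exp_pos _).le
  obtain ⟨K, ε, hε, hK⟩ := exists_rpow_mul_integral_exp_neg_dist_sq_le ν h hσ hσs
  refine Summable.of_nat_of_neg ?_ ?_
  · refine Summable.of_nonneg_of_le (fun n ↦ mul_nonneg (by positivity) (hnonneg _)) (fun n ↦ ?_)
      ((hgeom ε hε).mul_left K)
    rw [zpow_natCast]
    exact hK _ (one_le_pow₀ (by norm_num))
  · refine Summable.of_nonneg_of_le (fun n ↦ mul_nonneg (by positivity) (hnonneg _)) (fun n ↦ ?_)
      ((hgeom σ hσ).mul_right (ν.real univ))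
    rw [zpow_neg, zpow_natCast, inv_rpow (by positivity), ← rpow_neg (by positivity)]
    refine mul_le_mul_of_nonneg_left ?_ (by positivity)
    calc _ ≤ ∫ _, (1 : ℝ) ∂ν := by
          refine integral_mono (integrable_exp_neg_dist_sq ν (by positivity))
            (integrable_const _) fun p ↦ ?_
          rw [exp_le_one_iff, neg_nonpos]
          positivity
      _ = ν.real univ := by simp

lemma rpow_neg_le_exp_mul {b x u : ℝ} (hb : 0 ≤ b) (hx : 0 < x) (hxu : x ≤ u) (hux : u ≤ 2 * x) :
    u ^ (-b) ≤ rexp (4 * π) * x ^ (-b) * rexp (-(π * (x ^ 2)⁻¹) * u ^ 2) := by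
  have h1 : u ^ (-b) ≤ x ^ (-b) := rpow_le_rpow_of_nonpos hx hxu (by linarith)
  have h2 : 1 ≤ rexp (4 * π) * rexp (-(π * (x ^ 2)⁻¹) * u ^ 2) := by
    rw [← exp_add, one_le_exp_iff]
    have h3 : (x ^ 2)⁻¹ * u ^ 2 ≤ 4 := by
      rw [inv_mul_le_iff₀ (by positivity)]
      nlinarith
    nlinarith [pi_pos]
  calc u ^ (-b) ≤ x ^ (-b) * 1 := by rwa [mul_one]
    _ ≤ x ^ (-b) * (rexp (4 * π) * rexp (-(π * (x ^ 2)⁻¹) * u ^ 2)) := by gcongr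
    _ = _ := by ring

end Energy

lemma measure_compl_measSupport' {d : ℕ} (μ : Measure (EuclideanSpace ℝ (Fin d))) :
    μ (measSupport' μ)ᶜ = 0 := by
  have h : measSupport' μ = μ.support := by
    ext x
    exact Metric.nhds_basis_ball.mem_measureSupport.symm
  rw [h]
  exact Measure.measure_compl_support

lemma lintegral_norm_measFT_sq_mul_rpow_lt_top {d : ℕ} (μ : Measure (EuclideanSpace ℝ (Fin d)))
    [IsFiniteMeasure μ] {C s σ : ℝ}
    (h : ∀ r, 0 < r → (μ.prod μ).real {p | dist p.1 p.2 < r} ≤ C * r ^ s)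
    (hσ : 0 < σ) (hσs : σ < s) (hσd : σ < d) :
    ∫⁻ ξ, ENNReal.ofReal (‖measFT μ ξ‖ ^ 2 * ‖ξ‖ ^ (σ - d)) < ⊤ := by
  have hsum := (summable_zpow_rpow_mul_integral_exp_neg_dist_sq (μ.prod μ) h hσ hσs).mul_left
    (rexp (4 * π))
  let g : ℤ → EuclideanSpace ℝ (Fin d) → ℝ := fun k ξ ↦
    rexp (4 * π) * ((2 : ℝ) ^ k) ^ (-(d - σ)) *
      (‖measFT μ ξ‖ ^ 2 * rexp (-(π * (((2 : ℝ) ^ k) ^ 2)⁻¹) * ‖ξ‖ ^ 2))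
  have hg0 : ∀ k ξ, 0 ≤ g k ξ := fun k ξ ↦ by positivity
  have hgint : ∀ k, Integrable (g k) := fun k ↦
    (integral_norm_measFT_sq_mul_gaussian μ (t := (((2 : ℝ) ^ k) ^ 2)⁻¹)
      (by positivity)).1.const_mul _
  have hg : ∀ k, ∫ ξ, g k ξ = rexp (4 * π) * (((2 : ℝ) ^ k) ^ σ *
      ∫ p, rexp (-(π * ((2 : ℝ) ^ k) ^ 2 * dist p.1 p.2 ^ 2)) ∂(μ.prod μ)) := by
    intro k
    have hx : (0 : ℝ) < 2 ^ k := by positivity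
    simp only [g]
    generalize (2 : ℝ) ^ k = x at hx
    have hpow : x ^ (-(d - σ)) * (x ^ 2) ^ (d / 2 : ℝ) = x ^ σ := by
      rw [← rpow_natCast, ← rpow_mul hx.le, ← rpow_add hx]
      congr 1
      push_cast
      ring
    have hexp : ∀ p : EuclideanSpace ℝ (Fin d) × EuclideanSpace ℝ (Fin d),
        π * dist p.1 p.2 ^ 2 / (x ^ 2)⁻¹ = π * x ^ 2 * dist p.1 p.2 ^ 2 := fun p ↦ by
      rw [div_inv_eq_mul]
      ring
    rw [integral_const_mul, (integral_norm_measFT_sq_mul_gaussian μ (by positivity)).2,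
      integral_const_mul, inv_inv, ← hpow]
    simp only [hexp]
    ring
  have hpt : ∀ ξ : EuclideanSpace ℝ (Fin d), ENNReal.ofReal (‖measFT μ ξ‖ ^ 2 * ‖ξ‖ ^ (σ - d)) ≤
      ∑' k, ENNReal.ofReal (g k ξ) := by
    intro ξ
    rcases (norm_nonneg ξ).eq_or_lt with h0 | hpos
    · rw [← h0, zero_rpow (by linarith), mul_zero, ENNReal.ofReal_zero]
      exact zero_le
    · obtain ⟨k, hk1, hk2⟩ := exists_mem_Ico_zpow hpos (by norm_num : (1 : ℝ) < 2)
      rw [zpow_add_one₀ (by norm_num)] at hk2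
      refine le_trans (ENNReal.ofReal_le_ofReal ?_) (ENNReal.le_tsum k)
      have h1 := rpow_neg_le_exp_mul (b := d - σ) (by linarith) (by positivity) hk1 (by linarith)
      rw [neg_sub] at h1
      calc _ ≤ _ := mul_le_mul_of_nonneg_left h1 (by positivity)
        _ = g k ξ := by simp only [g, neg_sub]; ring
  calc ∫⁻ ξ, ENNReal.ofReal (‖measFT μ ξ‖ ^ 2 * ‖ξ‖ ^ (σ - d))
      ≤ ∫⁻ ξ, ∑' k, ENNReal.ofReal (g k ξ) := lintegral_mono hpt
    _ = ∑' k, ∫⁻ ξ, ENNReal.ofReal (g k ξ) :=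
        lintegral_tsum fun k ↦ (hgint k).aemeasurable.ennreal_ofReal
    _ = ∑' k : ℤ, ENNReal.ofReal (rexp (4 * π) * (((2 : ℝ) ^ k) ^ σ *
          ∫ p, rexp (-(π * ((2 : ℝ) ^ k) ^ 2 * dist p.1 p.2 ^ 2)) ∂(μ.prod μ))) := by
        congr with k
        rw [← hg, ofReal_integral_eq_lintegral_ofReal (hgint k) (.of_forall (hg0 k))]
    _ < ⊤ := hsum.tsum_ofReal_lt_top

theorem stmt_11 (d : ℕ) (ψ : (EuclideanSpace ℝ (Fin d)) → ℝ)
    (hψ_smooth : ContDiff ℝ (⊤ : ℕ∞) ψ) (hψ_supp : HasCompactSupport ψ)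
    (hψ_nonneg : ∀ x, 0 ≤ ψ x) (hψ_int : ∫ x, ψ x = 1)
    (μ : Measure (EuclideanSpace ℝ (Fin d))) [IsFiniteMeasure μ] (hμ : μ ≠ 0)
    (s : ℝ) (hs : s ∈ Set.Icc (0 : ℝ) d)
    (hL2 : ∃ δ₀ > 0, ∀ δ : ℝ, 0 < δ → δ ≤ δ₀ →
      ∫ x, (∫ y, δ ^ (-(d : ℝ)) * ψ (δ⁻¹ • (x - y)) ∂μ) ^ 2 ≤ δ ^ (s - d)) :
    (∀ σ : ℝ, 0 < σ → σ < s →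
      ∫⁻ ξ, ENNReal.ofReal (‖measFT μ ξ‖ ^ 2 * ‖ξ‖ ^ (σ - d)) < ⊤) ∧
    ENNReal.ofReal s ≤ dimH (measSupport' μ) := by
  obtain ⟨δ₀, hδ₀, hL2⟩ := hL2
  have hψ_ne : ψ ≠ 0 := by
    rintro rfl
    simp at hψ_int
  obtain ⟨C, hC⟩ := exists_prod_dist_lt_le μ hψ_smooth.continuous hψ_supp hψ_nonneg hψ_ne hδ₀ hs.1
    hL2
  refine ⟨fun σ hσ hσs ↦ lintegral_norm_measFT_sq_mul_rpow_lt_top μ hC hσ hσs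
    (hσs.trans_le hs.2), le_of_forall_lt fun b hb ↦ ?_⟩
  obtain ⟨σ, hσ, hbσ, hσs⟩ := ENNReal.lt_iff_exists_real_btwn.1 hb
  have hσ0 : 0 < σ := ENNReal.ofReal_pos.1 (zero_le.trans_lt hbσ)
  exact hbσ.trans_le (ofReal_le_dimH_of_prod_dist_lt_le hμ (measure_compl_measSupport' μ) hC hσ0
    (ENNReal.ofReal_lt_ofReal_iff'.1 hσs).1)
end
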